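/- arXiv:0801.1924 — 2 statements merged into one kernel-verified Lean document; each statement's English description precedes it below -/
import Mathlib

section
/- Let ω be any cookie environment with at most M cookies per site, i.e. ω(z,i) = 1/2 for all i > M, and let (X_n)_{n≥0} be the excited random walk started at 0 in environment ω. Then P_{0,ω}-almost surely both liminf_{n→∞} X_n and limsup_{n→∞} X_n belong to {−∞, +∞}. -/
open MeasureTheory ProbabilityTheory Filter Set
open scoped ENNReal NNReal Topology

noncomputable section

/-- A cookie environment with (at most) `M` cookies per site: `ω z i` is the probability of a
step to the right upon the `i`-th visit to site `z` (cookies are indexed by `i ≥ 1`),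
and all cookies beyond the `M`-th are placebo cookies. -/
def IsCookieEnv (M : ℕ) (ω : ℤ → ℕ → ℝ) : Prop :=
  (∀ z i, ω z i ∈ Set.Icc (0:ℝ) 1) ∧ ∀ z i, M < i → ω z i = (1:ℝ)/2

/-- The number of `i ≤ n` with `X i = X n` (the local time of the path `X` at its current
position at time `n`; it equals the number of the current visit). -/
def localTimeAt (X : ℕ → ℤ) (n : ℕ) : ℕ :=
  ((Finset.range (n+1)).filter (fun i => X i = X n)).card

/-- The cylinder event that a path agrees with `z` up to time `n`. -/
def prefixEvent (z : ℕ → ℤ) (n : ℕ) : Set (ℕ → ℤ) := {Y | ∀ i ≤ n, Y i = z i}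

/-- `P` is the law of the excited random walk started at `x` in the cookie environment `ω`:
it starts at `x` a.s., and conditionally on the path up to time `n` it jumps to the right with
probability `ω(X_n, #{i ≤ n : X_i = X_n})` and to the left with the complementary probability. -/
def IsERWLaw (ω : ℤ → ℕ → ℝ) (x : ℤ) (P : Measure (ℕ → ℤ)) : Prop :=
  IsProbabilityMeasure P ∧
  P {X | X 0 = x} = 1 ∧
  (∀ (n : ℕ) (z : ℕ → ℤ),
    P (prefixEvent z n ∩ {X | X (n+1) = z n + 1})
      = ENNReal.ofReal (ω (z n) (localTimeAt z n)) * P (prefixEvent z n)) ∧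
  (∀ (n : ℕ) (z : ℕ → ℤ),
    P (prefixEvent z n ∩ {X | X (n+1) = z n - 1})
      = ENNReal.ofReal (1 - ω (z n) (localTimeAt z n)) * P (prefixEvent z n))

lemma localTimeAt_congr {X Y : ℕ → ℤ} {n : ℕ} (h : ∀ i ≤ n, X i = Y i) :
    localTimeAt X n = localTimeAt Y n := by
  unfold localTimeAt
  congr 1
  refine Finset.filter_congr fun i hi => ?_
  rw [h i (by grind), h n le_rfl]

/-- A site visited infinitely often eventually has local time above any given level. -/
lemma eventually_lt_localTimeAt {X : ℕ → ℤ} {x : ℤ} (h : ∃ᶠ n in atTop, X n = x) (M : ℕ) :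
    ∀ᶠ n in atTop, X n = x → M < localTimeAt X n := by
  obtain ⟨t, ht, hcard⟩ :=
    (Nat.frequently_atTop_iff_infinite.1 h).exists_subset_card_eq (M + 1)
  filter_upwards [eventually_ge_atTop (t.sup id)] with n hn hx
  refine Nat.lt_of_succ_le (hcard.ge.trans (Finset.card_le_card fun i hi => ?_))
  have hi_sup : i ≤ t.sup id := Finset.le_sup (f := id) hi
  have hi_visit : X i = x := ht hi
  simp only [Finset.mem_filter, Finset.mem_range]
  exact ⟨by omega, hi_visit.trans hx.symm⟩

lemma tendsto_sum_atTop_of_frequently_le {f : ℕ → ℝ} (hf : ∀ n, 0 ≤ f n) {c : ℝ} (hc : 0 < c)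
    (h : ∃ᶠ n in atTop, c ≤ f n) :
    Tendsto (fun n => ∑ k ∈ Finset.range n, f k) atTop atTop := by
  rw [← not_summable_iff_tendsto_nat_atTop_of_nonneg hf]
  intro hs
  refine h ?_
  filter_upwards [hs.tendsto_atTop_zero.eventually (gt_mem_nhds hc)] with n hn
  exact not_le.2 hn

/-- The probability, given the path up to time `n`, of jumping from `x` in a direction whose jump
probabilities are given by `q`. -/
def jumpProb (q : ℤ → ℕ → ℝ) (x : ℤ) (n : ℕ) : (ℕ → ℤ) → ℝ :=
  {X : ℕ → ℤ | X n = x}.indicator fun X => q x (localTimeAt X n)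

lemma jumpProb_congr (q : ℤ → ℕ → ℝ) (x : ℤ) {n : ℕ} {X Y : ℕ → ℤ} (h : ∀ i ≤ n, X i = Y i) :
    jumpProb q x n X = jumpProb q x n Y := by
  simp [jumpProb, Set.indicator_apply, h n le_rfl, localTimeAt_congr h]

lemma jumpProb_mem_Icc {q : ℤ → ℕ → ℝ} (hq : ∀ z i, q z i ∈ Icc (0 : ℝ) 1) (x : ℤ) (n : ℕ)
    (X : ℕ → ℤ) : jumpProb q x n X ∈ Icc (0 : ℝ) 1 := by
  by_cases h : X n = x
  · simpa [jumpProb, h] using hq x (localTimeAt X n)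
  · simp [jumpProb, h]

/-- An extension by zero of a path defined up to time `n`. -/
def extendPath (n : ℕ) (b : Iic n → ℤ) (i : ℕ) : ℤ :=
  if h : i ≤ n then b ⟨i, h⟩ else 0

lemma extendPath_restrictLe {n i : ℕ} (hi : i ≤ n) (X : ℕ → ℤ) :
    extendPath n (Preorder.restrictLe n X) i = X i := by
  simp [extendPath, hi]

lemma restrictLe_preimage_singleton (n : ℕ) (b : Iic n → ℤ) :
    Preorder.restrictLe (π := fun _ => ℤ) n ⁻¹' {b} = prefixEvent (extendPath n b) n := by
  ext X
  simp only [mem_preimage, mem_singleton_iff, prefixEvent, mem_ofPred_eq]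
  constructor
  · rintro rfl i hi
    exact (extendPath_restrictLe hi X).symm
  · intro h
    funext ⟨i, hi⟩
    have hi' : i ≤ n := hi
    simpa [extendPath, hi'] using h i hi'

/-- The event that the path jumps by `d` from `x` between times `n - 1` and `n`. -/
def jumpEvent (x d : ℤ) (n : ℕ) : Set (ℕ → ℤ) := {X | X (n - 1) = x ∧ X n = x + d}

lemma measurableSet_piLE_jumpEvent (x d : ℤ) (n : ℕ) :
    MeasurableSet[Filtration.piLE (X := fun _ : ℕ => ℤ) n] (jumpEvent x d n) :=
  ⟨{b | b ⟨n - 1, Nat.sub_le n 1⟩ = x ∧ b ⟨n, le_refl n⟩ = x + d}, MeasurableSet.of_discrete, rfl⟩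

section

variable {q : ℤ → ℕ → ℝ} {d : ℤ} {P : Measure (ℕ → ℤ)}

lemma measure_prefixEvent_inter_jumpEvent
    (hP : ∀ (n : ℕ) (z : ℕ → ℤ), P (prefixEvent z n ∩ {X | X (n+1) = z n + d})
      = ENNReal.ofReal (q (z n) (localTimeAt z n)) * P (prefixEvent z n))
    (x : ℤ) (n : ℕ) (z : ℕ → ℤ) :
    P (prefixEvent z n ∩ jumpEvent x d (n + 1))
      = ENNReal.ofReal (jumpProb q x n z) * P (prefixEvent z n) := by
  by_cases hz : z n = x
  · have : prefixEvent z n ∩ jumpEvent x d (n + 1)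
        = prefixEvent z n ∩ {X | X (n + 1) = z n + d} := by
      ext X
      simp only [prefixEvent, jumpEvent, mem_inter_iff, mem_ofPred_eq, Nat.add_sub_cancel]
      grind
    rw [this, hP]
    simp [jumpProb, hz]
  · have : prefixEvent z n ∩ jumpEvent x d (n + 1) = ∅ := by
      ext X
      simp only [prefixEvent, jumpEvent, mem_inter_iff, mem_ofPred_eq, Nat.add_sub_cancel,
        mem_empty_iff_false, iff_false]
      grind
    simp [this, jumpProb, hz]

/-- The conditional probability of a jump given the past is `jumpProb`. -/
lemma jumpProb_ae_eq_condExp [IsProbabilityMeasure P] (hq : ∀ z i, q z i ∈ Icc (0 : ℝ) 1)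
    (hP : ∀ (n : ℕ) (z : ℕ → ℤ), P (prefixEvent z n ∩ {X | X (n+1) = z n + d})
      = ENNReal.ofReal (q (z n) (localTimeAt z n)) * P (prefixEvent z n))
    (x : ℤ) (n : ℕ) :
    jumpProb q x n =ᵐ[P] P[(jumpEvent x d (n + 1)).indicator (1 : (ℕ → ℤ) → ℝ) |
      Filtration.piLE (X := fun _ : ℕ => ℤ) n] := by
  let r : (ℕ → ℤ) → Iic n → ℤ := Preorder.restrictLe n
  let G : (Iic n → ℤ) → ℝ := fun b => jumpProb q x n (extendPath n b)
  have hG : jumpProb q x n = G ∘ r := by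
    funext X
    exact jumpProb_congr q x fun i hi => (extendPath_restrictLe hi X).symm
  have hr : Measurable r := Preorder.measurable_restrictLe n
  have hG_meas : Measurable G := measurable_of_countable G
  have hg_meas : Measurable (jumpProb q x n) := hG ▸ hG_meas.comp hr
  have hg_int : Integrable (jumpProb q x n) P := by
    refine Integrable.of_bound hg_meas.aestronglyMeasurable 1 (.of_forall fun X => ?_)
    have := jumpProb_mem_Icc hq x n X
    rw [Real.norm_of_nonneg this.1]
    exact this.2
  have hs : MeasurableSet (jumpEvent x d (n + 1)) :=
    (Filtration.piLE (X := fun _ : ℕ => ℤ)).le _ _ (measurableSet_piLE_jumpEvent x d (n + 1))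
  have hlaw : (P.map r).withDensity (fun b => ENNReal.ofReal (G b))
      = (P.restrict (jumpEvent x d (n + 1))).map r := by
    refine Measure.ext_of_singleton fun b => ?_
    rw [withDensity_apply _ (measurableSet_singleton b), lintegral_singleton,
      Measure.map_apply hr (measurableSet_singleton b),
      Measure.map_apply hr (measurableSet_singleton b),
      Measure.restrict_apply (hr (measurableSet_singleton b)),
      show r ⁻¹' {b} = _ from restrictLe_preimage_singleton n b,
      measure_prefixEvent_inter_jumpEvent hP]
  refine ae_eq_condExp_of_forall_setIntegral_eq (Filtration.le _ n)
    ((integrable_const 1).indicator hs) (fun _ _ _ => hg_int.integrableOn) ?_ ?_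
  · rintro _ ⟨B, hB, rfl⟩ -
    change ∫ X in r ⁻¹' B, _ ∂P = ∫ X in r ⁻¹' B, _ ∂P
    rw [integral_indicator_one hs,
      integral_eq_lintegral_of_nonneg_ae
        (.of_forall fun X => (jumpProb_mem_Icc hq x n X).1) hg_meas.aestronglyMeasurable]
    have h := congrArg (fun μ => μ B) hlaw
    simp only [withDensity_apply _ hB, Measure.map_apply hr hB,
      Measure.restrict_apply (hr hB)] at h
    rw [setLIntegral_map hB hG_meas.ennreal_ofReal hr] at h
    rw [measureReal_def, Measure.restrict_apply hs, inter_comm, ← h, hG]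
    rfl
  · refine Measurable.aestronglyMeasurable (m := Filtration.piLE (X := fun _ : ℕ => ℤ) n) ?_
    rw [hG]
    exact hG_meas.comp (comap_measurable r)

/-- If jumps by `d` are eventually fair at each site, then almost surely every site `x` visited
infinitely often has `x + d` visited infinitely often. -/
lemma ae_frequently_add_of_frequently [IsProbabilityMeasure P] {M : ℕ}
    (hq : ∀ z i, q z i ∈ Icc (0 : ℝ) 1) (hqM : ∀ z i, M < i → q z i = 1 / 2)
    (hP : ∀ (n : ℕ) (z : ℕ → ℤ), P (prefixEvent z n ∩ {X | X (n+1) = z n + d})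
      = ENNReal.ofReal (q (z n) (localTimeAt z n)) * P (prefixEvent z n)) :
    ∀ᵐ X ∂P, ∀ x : ℤ, (∃ᶠ n in atTop, X n = x) → ∃ᶠ n in atTop, X n = x + d := by
  rw [ae_all_iff]
  intro x
  filter_upwards [ae_mem_limsup_atTop_iff P (measurableSet_piLE_jumpEvent x d),
    ae_all_iff.2 (jumpProb_ae_eq_condExp hq hP x)] with X hX hcond hfreq
  simp_rw [← hcond] at hX
  have hmem := hX.2 <| tendsto_sum_atTop_of_frequently_le
    (fun n => (jumpProb_mem_Icc hq x n X).1) (half_pos one_pos) <|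
    (hfreq.and_eventually (eventually_lt_localTimeAt hfreq M)).mono fun n hn => by
      simp [jumpProb, hn.1, hqM x _ (hn.2 hn.1)]
  rw [mem_limsup_iff_frequently_mem] at hmem
  exact hmem.mono fun n hn => hn.2

end

/-- An integer sequence that is frequently in a bounded interval visits some site infinitely
often. -/
lemma exists_frequently_eq_of_frequently_mem_Ioo {X : ℕ → ℤ} {a b : ℝ}
    (h : ∃ᶠ n in atTop, (X n : ℝ) ∈ Ioo a b) : ∃ x, ∃ᶠ n in atTop, X n = x := by
  by_contra! hX
  refine h ?_
  have := (eventually_all_finite (finite_Icc ⌊a⌋ ⌈b⌉)).2 fun x _ => hX x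
  filter_upwards [this] with n hn hab
  refine hn (X n) ⟨?_, ?_⟩ rfl
  · exact_mod_cast (Int.floor_le a).trans hab.1.le
  · exact_mod_cast hab.2.le.trans (Int.le_ceil b)

lemma liminf_limsup_mem_of_forall_not_frequently {X : ℕ → ℤ}
    (h : ∀ x, ¬ ∃ᶠ n in atTop, X n = x) :
    liminf (fun n : ℕ => ((X n : ℝ) : EReal)) atTop ∈ ({⊥, ⊤} : Set EReal) ∧
      limsup (fun n : ℕ => ((X n : ℝ) : EReal)) atTop ∈ ({⊥, ⊤} : Set EReal) := by
  refine ⟨?_, ?_⟩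
  · induction hL : liminf (fun n : ℕ => ((X n : ℝ) : EReal)) atTop with
    | bot => simp
    | top => simp
    | coe c =>
      have h1 : ∃ᶠ n in atTop, ((X n : ℝ) : EReal) < ((c + 1 : ℝ) : EReal) :=
        frequently_lt_of_liminf_lt (by isBoundedDefault)
          (hL ▸ EReal.coe_lt_coe_iff.2 (lt_add_one c))
      have h2 : ∀ᶠ n in atTop, ((c - 1 : ℝ) : EReal) < ((X n : ℝ) : EReal) :=
        eventually_lt_of_lt_liminf (hL ▸ EReal.coe_lt_coe_iff.2 (sub_one_lt c))
      obtain ⟨x, hx⟩ := exists_frequently_eq_of_frequently_mem_Ioo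
        ((h1.and_eventually h2).mono fun n hn =>
          ⟨EReal.coe_lt_coe_iff.1 hn.2, EReal.coe_lt_coe_iff.1 hn.1⟩)
      exact absurd hx (h x)
  · induction hL : limsup (fun n : ℕ => ((X n : ℝ) : EReal)) atTop with
    | bot => simp
    | top => simp
    | coe c =>
      have h1 : ∃ᶠ n in atTop, ((c - 1 : ℝ) : EReal) < ((X n : ℝ) : EReal) :=
        frequently_lt_of_lt_limsup (by isBoundedDefault)
          (hL ▸ EReal.coe_lt_coe_iff.2 (sub_one_lt c))
      have h2 : ∀ᶠ n in atTop, ((X n : ℝ) : EReal) < ((c + 1 : ℝ) : EReal) :=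
        eventually_lt_of_limsup_lt (hL ▸ EReal.coe_lt_coe_iff.2 (lt_add_one c))
      obtain ⟨x, hx⟩ := exists_frequently_eq_of_frequently_mem_Ioo
        ((h1.and_eventually h2).mono fun n hn =>
          ⟨EReal.coe_lt_coe_iff.1 hn.1, EReal.coe_lt_coe_iff.1 hn.2⟩)
      exact absurd hx (h x)

lemma liminf_eq_bot_limsup_eq_top_of_forall_frequently {X : ℕ → ℤ}
    (h : ∀ x, ∃ᶠ n in atTop, X n = x) :
    liminf (fun n : ℕ => ((X n : ℝ) : EReal)) atTop = ⊥ ∧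
      limsup (fun n : ℕ => ((X n : ℝ) : EReal)) atTop = ⊤ := by
  refine ⟨EReal.eq_bot_iff_forall_lt _ |>.2 fun y => ?_,
    EReal.eq_top_iff_forall_lt _ |>.2 fun y => ?_⟩
  · obtain ⟨x, hx⟩ := exists_int_lt y
    refine (liminf_le_of_frequently_le' ((h x).mono fun n hn => ?_)).trans_lt
      (EReal.coe_lt_coe_iff.2 hx)
    rw [hn]
  · obtain ⟨x, hx⟩ := exists_int_gt y
    refine (EReal.coe_lt_coe_iff.2 hx).trans_le
      (le_limsup_of_frequently_le' ((h x).mono fun n hn => ?_))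
    rw [hn]

/-- **Lemma 3.** For every cookie environment `ω` with at most `M` cookies per site and the
excited random walk started at `0` in `ω`, `P_{0,ω}`-a.s. both `liminf X_n` and
`limsup X_n` belong to `{-∞, +∞}`. -/
theorem erw_liminf_limsup_pm_infinity
    (M : ℕ) (hM : 1 ≤ M) (ω : ℤ → ℕ → ℝ) (hω : IsCookieEnv M ω)
    (P : Measure (ℕ → ℤ)) (hP : IsERWLaw ω 0 P) :
    P {X | Filter.liminf (fun n : ℕ => ((X n : ℝ) : EReal)) atTop ∈ ({⊥, ⊤} : Set EReal) ∧
           Filter.limsup (fun n : ℕ => ((X n : ℝ) : EReal)) atTop ∈ ({⊥, ⊤} : Set EReal)}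
      = 1 := by
  have := hP.1
  have hL : ∀ z i, 1 - ω z i ∈ Icc (0 : ℝ) 1 := fun z i =>
    ⟨sub_nonneg.2 (hω.1 z i).2, sub_le_self _ (hω.1 z i).1⟩
  have hLM : ∀ z i, M < i → 1 - ω z i = 1 / 2 := fun z i hi => by
    rw [hω.2 z i hi]
    norm_num
  rw [← measure_univ (μ := P)]
  refine measure_congr (eventuallyEq_univ.2 ?_)
  filter_upwards [ae_frequently_add_of_frequently hω.1 hω.2 hP.2.2.1,
    ae_frequently_add_of_frequently (d := -1) (q := fun z i => 1 - ω z i) hL hLM hP.2.2.2]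
    with X hright hleft
  by_cases h : ∃ x, ∃ᶠ n in atTop, X n = x
  · obtain ⟨x, hx⟩ := h
    obtain ⟨h1, h2⟩ := liminf_eq_bot_limsup_eq_top_of_forall_frequently fun y =>
      Int.inductionOn' y x hx (fun k _ hk => hright k hk) fun k _ hk => hleft k hk
    exact ⟨Or.inl h1, Or.inr h2⟩
  · exact liminf_limsup_mem_of_forall_not_frequently (not_exists.1 h)
end
end

section
/- Let K be the transition matrix of a positive recurrent Markov chain on the state space ℕ₀ with invariant probability distribution π, and assume all entries of K are strictly positive. Fix a state j ∈ ℕ₀ and a finite set J ⊂ ℕ₀ \ {j}, and define a new transition matrix K̄ by K̄(i,·) := K(i,·) for i ∉ J and K̄(i,·) := K(j,·) for i ∈ J. Then a Markov chain with transition matrix K̄ is also positive recurrent, and its unique invariant probability distribution π̄ satisfies π̄(n) ≤ c·π(n) for all n ∈ ℕ₀, for some constant c ∈ (0,∞). -/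
open MeasureTheory ProbabilityTheory Filter Set
open scoped ENNReal NNReal Topology

noncomputable section

/-- Taboo probabilities: `tabooProb K i n j` is the probability that a Markov chain with
transition matrix `K` started at `i` is at `j` at time `n` without having revisited `i` at
any of the times `1, …, n`. -/
def tabooProb (K : ℕ → ℕ → ℝ≥0∞) (i : ℕ) : ℕ → ℕ → ℝ≥0∞
  | 0, j => if j = i then 1 else 0
  | n+1, j => if j = i then 0 else ∑' l, tabooProb K i n l * K l j

/-- The distribution of the first return time to `i` of the chain with transition matrix `K`
started at `i`. -/
def firstReturnProb (K : ℕ → ℕ → ℝ≥0∞) (i : ℕ) : ℕ → ℝ≥0∞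
  | 0 => 0
  | n+1 => ∑' l, tabooProb K i n l * K l i

/-- `K` is a stochastic matrix on ℕ₀. -/
def IsStochasticMatrix (K : ℕ → ℕ → ℝ≥0∞) : Prop := ∀ i, ∑' j, K i j = 1

/-- The chain with transition matrix `K` is positive recurrent: from every state, the first
return time is a.s. finite and has finite expectation. -/
def IsPositiveRecurrent (K : ℕ → ℕ → ℝ≥0∞) : Prop :=
  ∀ i, (∑' n, firstReturnProb K i n = 1) ∧ (∑' n : ℕ, (n : ℝ≥0∞) * firstReturnProb K i n ≠ ⊤)

/-- `π` is an invariant probability distribution for the transition matrix `K`. -/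
def IsInvariantDist (K : ℕ → ℕ → ℝ≥0∞) (π : ℕ → ℝ≥0∞) : Prop :=
  (∑' n, π n = 1) ∧ ∀ j, ∑' i, π i * K i j = π j

/-- The probability that the chain with transition matrix `K` started at `i` is at `m` at time
`k + 1` without having visited `A` at any of the times `1, …, k`. -/
def hitProb (K : ℕ → ℕ → ℝ≥0∞) (i : ℕ) (A : Finset ℕ) : ℕ → ℕ → ℝ≥0∞
  | 0, m => K i m
  | k + 1, m => ∑' l, (if l ∈ A then 0 else hitProb K i A k l) * K l m

/-- The expected number of visits to `m` up to and including the first positive time at which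
the chain started at `i` is in `A`. -/
def expectedVisits (K : ℕ → ℕ → ℝ≥0∞) (i : ℕ) (A : Finset ℕ) (m : ℕ) : ℝ≥0∞ :=
  ∑' k, hitProb K i A k m

section

variable {K : ℕ → ℕ → ℝ≥0∞} {π : ℕ → ℝ≥0∞} {i : ℕ} {A : Finset ℕ}

lemma expectedVisits_eq (K : ℕ → ℕ → ℝ≥0∞) (i : ℕ) (A : Finset ℕ) (m : ℕ) :
    expectedVisits K i A m =
      K i m + ∑' l, (if l ∈ A then 0 else expectedVisits K i A l) * K l m := by
  unfold expectedVisits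
  rw [tsum_eq_zero_add' ENNReal.summable]
  simp only [hitProb]
  rw [ENNReal.tsum_comm]
  congr 1
  refine tsum_congr fun l => ?_
  split_ifs with h
  · simp
  · rw [ENNReal.tsum_mul_right]

lemma IsInvariantDist.ne_top (hπ : IsInvariantDist K π) (m : ℕ) : π m ≠ ⊤ :=
  ENNReal.ne_top_of_tsum_ne_top (by simp [hπ.1]) m

lemma IsInvariantDist.pos (hpos : ∀ i j, 0 < K i j) (hπ : IsInvariantDist K π) (m : ℕ) :
    0 < π m := by
  rw [pos_iff_ne_zero]
  intro h0
  have h := hπ.2 m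
  rw [h0, ENNReal.tsum_eq_zero] at h
  have hz : ∀ l, π l = 0 := fun l => (mul_eq_zero.1 (h l)).resolve_right (hpos l m).ne'
  simpa [hz] using hπ.1

/-- Occupation measures of excursions are dominated by the invariant distribution. -/
lemma IsInvariantDist.mul_expectedVisits_le (hπ : IsInvariantDist K π) (hi : i ∈ A) (m : ℕ) :
    π i * expectedVisits K i A m ≤ π m := by
  have key : ∀ N m, π i * ∑ k ∈ Finset.range N, hitProb K i A k m ≤ π m := by
    intro N
    induction N with
    | zero => simp
    | succ N ih =>
      intro m
      have hstep : ∑ k ∈ Finset.range N, hitProb K i A (k + 1) m =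
          ∑' l, (if l ∈ A then 0 else ∑ k ∈ Finset.range N, hitProb K i A k l) * K l m := by
        simp only [hitProb]
        rw [← Summable.tsum_finsetSum fun _ _ => ENNReal.summable]
        refine tsum_congr fun l => ?_
        split_ifs <;> simp [Finset.sum_mul]
      have hsingle : π i * K i m = ∑' l, if l = i then π i * K i m else 0 :=
        (tsum_ite_eq i fun _ => π i * K i m).symm
      rw [Finset.sum_range_succ', hstep, mul_add, ← ENNReal.tsum_mul_left]
      simp only [hitProb]
      rw [hsingle, ← ENNReal.tsum_add, ← hπ.2 m]
      refine ENNReal.tsum_le_tsum fun l => ?_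
      by_cases hl : l = i
      · subst hl; simp [hi]
      · by_cases hA : l ∈ A
        · simp [hA, hl]
        · simp only [hA, hl, if_false, add_zero]
          rw [← mul_assoc]
          gcongr
          exact ih l
  rw [expectedVisits, ENNReal.tsum_eq_iSup_nat, ENNReal.mul_iSup]
  exact iSup_le fun N => key N m

lemma IsInvariantDist.tsum_expectedVisits_ne_top (hpos : ∀ i j, 0 < K i j)
    (hπ : IsInvariantDist K π) (hi : i ∈ A) : ∑' m, expectedVisits K i A m ≠ ⊤ := by
  intro htop
  have h : π i * ∑' m, expectedVisits K i A m ≤ 1 := by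
    rw [← ENNReal.tsum_mul_left, ← hπ.1]
    exact ENNReal.tsum_le_tsum fun m => hπ.mul_expectedVisits_le hi m
  rw [htop, ENNReal.mul_top (hπ.pos hpos i).ne'] at h
  simp at h

/-- The set `A` is hit exactly once, almost surely, during an excursion. -/
lemma IsInvariantDist.tsum_expectedVisits_mem (hK : IsStochasticMatrix K)
    (hpos : ∀ i j, 0 < K i j) (hπ : IsInvariantDist K π) (hi : i ∈ A) :
    ∑' m, (if m ∈ A then expectedVisits K i A m else 0) = 1 := by
  have hfin := hπ.tsum_expectedVisits_ne_top hpos hi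
  have htotal : ∑' m, expectedVisits K i A m =
      1 + ∑' l, (if l ∈ A then 0 else expectedVisits K i A l) := by
    rw [tsum_congr (expectedVisits_eq K i A), ENNReal.tsum_add, hK i, ENNReal.tsum_comm]
    simp only [ENNReal.tsum_mul_left, hK _, mul_one]
  have hsplit : ∑' m, expectedVisits K i A m =
      ∑' m, (if m ∈ A then expectedVisits K i A m else 0) +
        ∑' l, (if l ∈ A then 0 else expectedVisits K i A l) := by
    rw [← ENNReal.tsum_add]
    refine tsum_congr fun m => ?_
    split_ifs <;> simp
  rw [htotal] at hsplit hfin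
  exact ((ENNReal.add_left_inj (ENNReal.add_ne_top.1 hfin).2).1 hsplit).symm

/-- If every row of `L` with index in `A` is the `i`-th row of `K`, and the other rows agree with
those of `K`, then the occupation measure is invariant under `L`. -/
lemma IsInvariantDist.tsum_expectedVisits_mul (hK : IsStochasticMatrix K)
    (hpos : ∀ i j, 0 < K i j) (hπ : IsInvariantDist K π) (hi : i ∈ A)
    {L : ℕ → ℕ → ℝ≥0∞} (hL : ∀ l, L l = if l ∈ A then K i else K l) (m : ℕ) :
    ∑' l, expectedVisits K i A l * L l m = expectedVisits K i A m := by
  rw [expectedVisits_eq K i A m, ← one_mul (K i m), ← hπ.tsum_expectedVisits_mem hK hpos hi,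
    ← ENNReal.tsum_mul_right, ← ENNReal.tsum_add]
  refine tsum_congr fun l => ?_
  rw [hL l]
  split_ifs <;> simp

lemma IsInvariantDist.expectedVisits_self (hK : IsStochasticMatrix K)
    (hpos : ∀ i j, 0 < K i j) (hπ : IsInvariantDist K π) (i : ℕ) :
    expectedVisits K i {i} i = 1 := by
  simpa using hπ.tsum_expectedVisits_mem hK hpos (Finset.mem_singleton_self i)

lemma IsInvariantDist.eq_mul_expectedVisits (hK : IsStochasticMatrix K)
    (hpos : ∀ i j, 0 < K i j) (hπ : IsInvariantDist K π) (i m : ℕ) :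
    π m = π i * expectedVisits K i {i} m := by
  have hi := Finset.mem_singleton_self i
  have hle := fun l => hπ.mul_expectedVisits_le hi l
  refine le_antisymm (not_lt.1 fun hlt => ?_) (hle m)
  have hinv : ∑' l, π i * expectedVisits K i {i} l * K l i = π i := by
    simp only [mul_assoc]
    rw [ENNReal.tsum_mul_left, hπ.tsum_expectedVisits_mul hK hpos hi (L := K),
      hπ.expectedVisits_self hK hpos, mul_one]
    intro l
    split_ifs with h
    · rw [Finset.mem_singleton.1 h]
    · rfl
  have hKm : K m i ≠ ⊤ := ENNReal.ne_top_of_tsum_ne_top (by simp [hK m]) i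
  have h := ENNReal.tsum_lt_tsum (i := m) (f := fun l => π i * expectedVisits K i {i} l * K l i)
    (g := fun l => π l * K l i) (by rw [hinv]; exact hπ.ne_top i)
    (fun l => by gcongr; exact hle l)
    (ENNReal.mul_lt_mul_left (hpos m i).ne' hKm hlt)
  rw [hinv, hπ.2 i] at h
  exact h.false

lemma IsInvariantDist.unique (hK : IsStochasticMatrix K) (hpos : ∀ i j, 0 < K i j)
    (hπ : IsInvariantDist K π) {π' : ℕ → ℝ≥0∞} (hπ' : IsInvariantDist K π') : π' = π := by
  have hinv : ∀ μ, IsInvariantDist K μ → μ 0 = (∑' m, expectedVisits K 0 {0} m)⁻¹ := by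
    intro μ hμ
    refine ENNReal.eq_inv_of_mul_eq_one_left ?_
    rw [← ENNReal.tsum_mul_left, ← hμ.1]
    exact tsum_congr fun m => (hμ.eq_mul_expectedVisits hK hpos 0 m).symm
  funext m
  rw [hπ'.eq_mul_expectedVisits hK hpos 0 m, hπ.eq_mul_expectedVisits hK hpos 0 m,
    hinv π hπ, hinv π' hπ']

lemma tsum_tabooProb_mul (K : ℕ → ℕ → ℝ≥0∞) (i n m : ℕ) :
    ∑' l, tabooProb K i n l * K l m = hitProb K i {i} n m := by
  induction n generalizing m with
  | zero => simp [tabooProb, hitProb]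
  | succ n ih => simp [tabooProb, hitProb, ih]

lemma firstReturnProb_succ (K : ℕ → ℕ → ℝ≥0∞) (i n : ℕ) :
    firstReturnProb K i (n + 1) = hitProb K i {i} n i :=
  tsum_tabooProb_mul K i n i

/-- Tail-sum bound: the truncated mean return time is at most the expected excursion length. -/
lemma sum_mul_hitProb_add (hK : IsStochasticMatrix K) (i N : ℕ) :
    ∑ n ∈ Finset.range N, ((n + 1 : ℕ) : ℝ≥0∞) * hitProb K i {i} n i +
      N * ∑' m, hitProb K i {i} N m = ∑ n ∈ Finset.range N, ∑' m, hitProb K i {i} n m := by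
  induction N with
  | zero => simp
  | succ N ih =>
    have hsplit : ∑' m, hitProb K i {i} N m =
        hitProb K i {i} N i + ∑' m, hitProb K i {i} (N + 1) m := by
      have hmass : ∑' m, hitProb K i {i} (N + 1) m =
          ∑' l, (if l ∈ ({i} : Finset ℕ) then 0 else hitProb K i {i} N l) := by
        simp only [hitProb]
        rw [ENNReal.tsum_comm]
        simp only [ENNReal.tsum_mul_left, hK _, mul_one]
      rw [hmass, ← tsum_ite_eq i (fun _ => hitProb K i {i} N i), ← ENNReal.tsum_add]
      refine tsum_congr fun l => ?_
      by_cases h : l = i <;> simp [h]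
    rw [Finset.sum_range_succ, Finset.sum_range_succ, ← ih, add_assoc, ← mul_add, ← hsplit]
    push_cast
    ring

/-- An entrywise positive stochastic matrix with an invariant distribution is positive
recurrent. -/
lemma IsInvariantDist.isPositiveRecurrent (hK : IsStochasticMatrix K)
    (hpos : ∀ i j, 0 < K i j) (hπ : IsInvariantDist K π) : IsPositiveRecurrent K := by
  intro i
  constructor
  · rw [tsum_eq_zero_add' ENNReal.summable]
    simp only [firstReturnProb_succ]
    simpa [firstReturnProb, expectedVisits] using hπ.expectedVisits_self hK hpos i
  · rw [tsum_eq_zero_add' ENNReal.summable]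
    simp only [firstReturnProb_succ, Nat.cast_zero, zero_mul, zero_add]
    refine ne_top_of_le_ne_top
      (hπ.tsum_expectedVisits_ne_top hpos (Finset.mem_singleton_self i)) ?_
    unfold expectedVisits
    rw [ENNReal.tsum_comm, ENNReal.tsum_eq_iSup_nat]
    refine iSup_le fun N => ?_
    refine le_trans ?_ (ENNReal.sum_le_tsum (Finset.range N))
    rw [← sum_mul_hitProb_add hK]
    exact le_self_add

end

/-- **Lemma 14 (modified Markov chain).** Let `K` be the transition matrix of a positive
recurrent Markov chain on ℕ₀ with invariant probability distribution `π`, with all entries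
strictly positive. Fix `j ∈ ℕ₀` and a finite `J ⊆ ℕ₀ \ {j}`, and let `K̄` coincide with `K`
off `J` and have rows `K(j,·)` on `J`. Then the chain with transition matrix `K̄` is positive
recurrent and its unique invariant probability distribution `π̄` satisfies `π̄(n) ≤ c π(n)`
for all `n`, for some constant `c ∈ (0,∞)`. -/
theorem modified_chain_positive_recurrent
    (K : ℕ → ℕ → ℝ≥0∞) (hK : IsStochasticMatrix K)
    (hpos : ∀ i j, 0 < K i j)
    (hrec : IsPositiveRecurrent K)
    (π : ℕ → ℝ≥0∞) (hπ : IsInvariantDist K π)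
    (j : ℕ) (J : Finset ℕ) (hjJ : j ∉ J)
    (Kbar : ℕ → ℕ → ℝ≥0∞)
    (hKbar : ∀ i, Kbar i = if i ∈ J then K j else K i) :
    IsPositiveRecurrent Kbar ∧
    ∃ πb : ℕ → ℝ≥0∞, IsInvariantDist Kbar πb ∧
      (∀ π', IsInvariantDist Kbar π' → π' = πb) ∧
      ∃ c : ℝ≥0∞, 0 < c ∧ c ≠ ⊤ ∧ ∀ n, πb n ≤ c * π n := by
  have hK' : IsStochasticMatrix Kbar := fun i => by
    rw [hKbar i]
    split_ifs
    · exact hK j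
    · exact hK i
  have hpos' : ∀ i m, 0 < Kbar i m := fun i m => by
    rw [hKbar i]
    split_ifs
    · exact hpos j m
    · exact hpos i m
  set A : Finset ℕ := insert j J
  have hjA : j ∈ A := Finset.mem_insert_self j J
  have hL : ∀ l, Kbar l = if l ∈ A then K j else K l := fun l => by
    rw [hKbar l]
    by_cases h : l = j <;> simp [A, h]
  set G := ∑' m, expectedVisits K j A m with hG
  have hG_top : G ≠ ⊤ := hπ.tsum_expectedVisits_ne_top hpos hjA
  have hG_zero : G ≠ 0 := by
    intro h
    have hz := ENNReal.tsum_eq_zero.1 h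
    simpa [hz] using hπ.tsum_expectedVisits_mem hK hpos hjA
  have hinv : IsInvariantDist Kbar fun m => G⁻¹ * expectedVisits K j A m := by
    refine ⟨?_, fun m => ?_⟩
    · rw [ENNReal.tsum_mul_left, ENNReal.inv_mul_cancel hG_zero hG_top]
    · simp only [mul_assoc]
      rw [ENNReal.tsum_mul_left, hπ.tsum_expectedVisits_mul hK hpos hjA hL]
  have hj := hπ.pos hpos j
  refine ⟨hinv.isPositiveRecurrent hK' hpos', _, hinv,
    fun π' h => hinv.unique hK' hpos' h, G⁻¹ * (π j)⁻¹, ?_, ?_, fun n => ?_⟩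
  · exact ENNReal.mul_pos (ENNReal.inv_ne_zero.2 hG_top) (ENNReal.inv_ne_zero.2 (hπ.ne_top j))
  · exact ENNReal.mul_ne_top (ENNReal.inv_ne_top.2 hG_zero) (ENNReal.inv_ne_top.2 hj.ne')
  · rw [mul_assoc]
    gcongr
    rw [mul_comm, ← div_eq_mul_inv, ENNReal.le_div_iff_mul_le (Or.inl hj.ne')
      (Or.inl (hπ.ne_top j)), mul_comm]
    exact hπ.mul_expectedVisits_le hjA n
end
end
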